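/- Let q, d ≥ 1 be integers and p ∈ ℤ. For z₁, …, z_q ∈ ℂ and k ∈ ℤ/q let diag_k(z₁, …, z_q) denote the q×q matrix whose (i,j) entry is z_i if j − i ≡ k (mod q) and 0 otherwise. Consider the continuous loop γ : S¹ → U(qd)/(I_q ⊗ U(d)) sending z to the coset of diag_{q−1}(z^p, 1, …, 1) ⊗ I_d. Then γ is nullhomotopic if and only if q divides p·d. In particular, if gcd(p,q) = 1, then γ is nullhomotopic if and only if q divides d. -/

import Mathlib

open Kronecker

variable (q : ℕ) [NeZero q]

noncomputable def shiftDiagMatrix (p : ℤ) (z : Circle) : Matrix (ZMod q) (ZMod q) ℂ :=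
  Matrix.of fun i j : ZMod q =>
    if j - i = ((q - 1 : ℕ) : ZMod q) then (if i = 0 then ((z ^ p : Circle) : ℂ) else 1) else 0

lemma shiftDiagMatrix_decomp (p : ℤ) (z : Circle) :
    shiftDiagMatrix q p z =
      (Matrix.diagonal fun i : ZMod q => if i = 0 then ((z ^ p : Circle) : ℂ) else 1) *
        (Equiv.addRight (((q - 1 : ℕ) : ZMod q))).toPEquiv.toMatrix := by
  rw [PEquiv.mul_toMatrix_toPEquiv]
  ext i j
  set c : ZMod q := ((q - 1 : ℕ) : ZMod q) with hc
  by_cases h : j - i = c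
  · have h2 : i = j + -c := by rw [← h]; abel
    simp [shiftDiagMatrix, ← hc, h, ← h2, Matrix.diagonal_apply, Equiv.addRight_symm,
      Matrix.submatrix_apply]
  · have h2 : ¬ i = j + -c := fun hcc => h (by rw [hcc]; abel)
    simp [shiftDiagMatrix, ← hc, h, h2, Matrix.diagonal_apply, Equiv.addRight_symm,
      Matrix.submatrix_apply]

lemma perm_mem_unitaryGroup {n : Type*} [Fintype n] [DecidableEq n] (σ : Equiv.Perm n) :
    σ.toPEquiv.toMatrix ∈ Matrix.unitaryGroup n ℂ := by
  rw [Matrix.mem_unitaryGroup_iff']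
  have hstar : (star (σ.toPEquiv.toMatrix : Matrix n n ℂ)) = σ.symm.toPEquiv.toMatrix := by
    rw [Equiv.toPEquiv_symm, PEquiv.toMatrix_symm]
    ext i j
    simp only [Matrix.star_apply, Matrix.transpose_apply, PEquiv.toMatrix_apply]
    rw [apply_ite star, star_one, star_zero]
  rw [hstar, ← PEquiv.toMatrix_trans, ← Equiv.toPEquiv_trans, Equiv.symm_trans_self,
    Equiv.toPEquiv_refl, PEquiv.toMatrix_refl]

lemma diag_circle_mem_unitaryGroup {n : Type*} [Fintype n] [DecidableEq n] (f : n → ℂ)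
    (hf : ∀ i, Complex.normSq (f i) = 1) :
    Matrix.diagonal f ∈ Matrix.unitaryGroup n ℂ := by
  rw [Matrix.mem_unitaryGroup_iff', Matrix.star_eq_conjTranspose, Matrix.diagonal_conjTranspose,
    Matrix.diagonal_mul_diagonal]
  have hsf : star f * f = 1 := by
    funext i
    rw [Pi.mul_apply, Pi.star_apply, Pi.one_apply, Complex.star_def, mul_comm,
      Complex.mul_conj, hf i, Complex.ofReal_one]
  have h1 : (Matrix.diagonal fun i => star f i * f i) = Matrix.diagonal (star f * f) := rfl
  rw [h1, hsf]
  exact Matrix.diagonal_one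

lemma shiftDiagMatrix_mem (p : ℤ) (z : Circle) :
    shiftDiagMatrix q p z ∈ Matrix.unitaryGroup (ZMod q) ℂ := by
  rw [shiftDiagMatrix_decomp]
  apply Submonoid.mul_mem
  · apply diag_circle_mem_unitaryGroup
    intro i
    by_cases h : i = 0 <;> simp [h]
  · exact perm_mem_unitaryGroup _

lemma star_kronecker_star' {m n : Type*} [Fintype m] [Fintype n] [DecidableEq m] [DecidableEq n]
    (A : Matrix m m ℂ) (B : Matrix n n ℂ) : star (A ⊗ₖ B) = star A ⊗ₖ star B := by
  ext ⟨i, i'⟩ ⟨j, j'⟩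
  simp [Matrix.star_apply, Matrix.kroneckerMap_apply, star_mul', Matrix.conjTranspose_apply,
    mul_comm]

lemma kronecker_one_mem_unitaryGroup {m n : Type*} [Fintype m] [Fintype n] [DecidableEq m]
    [DecidableEq n] {A : Matrix m m ℂ} (hA : A ∈ Matrix.unitaryGroup m ℂ) :
    A ⊗ₖ (1 : Matrix n n ℂ) ∈ Matrix.unitaryGroup (m × n) ℂ := by
  rw [Matrix.mem_unitaryGroup_iff']
  rw [star_kronecker_star', star_one, ← Matrix.mul_kronecker_mul,
    Matrix.mem_unitaryGroup_iff'.mp hA, one_mul, Matrix.one_kronecker_one]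

def oneTensorUnitary' (d : ℕ) : Subgroup (Matrix.unitaryGroup (ZMod q × Fin d) ℂ) where
  carrier := {u | ∃ v : Matrix.unitaryGroup (Fin d) ℂ,
    (u : Matrix (ZMod q × Fin d) (ZMod q × Fin d) ℂ)
      = (1 : Matrix (ZMod q) (ZMod q) ℂ) ⊗ₖ (v : Matrix (Fin d) (Fin d) ℂ)}
  one_mem' := ⟨1, by simp [Matrix.one_kronecker_one]⟩
  mul_mem' := by
    rintro a b ⟨v, hv⟩ ⟨w, hw⟩
    refine ⟨v * w, ?_⟩
    have hvw : ((v * w : Matrix.unitaryGroup (Fin d) ℂ) : Matrix (Fin d) (Fin d) ℂ)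
        = (v : Matrix (Fin d) (Fin d) ℂ) * w := rfl
    rw [Matrix.UnitaryGroup.mul_val, hv, hw, hvw, ← Matrix.mul_kronecker_mul, one_mul]
  inv_mem' := by
    rintro a ⟨v, hv⟩
    refine ⟨v⁻¹, ?_⟩
    rw [Matrix.UnitaryGroup.inv_val, hv, star_kronecker_star', star_one,
      Matrix.UnitaryGroup.inv_val]

noncomputable def shiftDiagLoop (d : ℕ) (p : ℤ) :
    C(Circle, Matrix.unitaryGroup (ZMod q × Fin d) ℂ ⧸ oneTensorUnitary' q d) where
  toFun z := QuotientGroup.mk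
    (⟨shiftDiagMatrix q p z ⊗ₖ (1 : Matrix (Fin d) (Fin d) ℂ),
      kronecker_one_mem_unitaryGroup (shiftDiagMatrix_mem q p z)⟩ :
      Matrix.unitaryGroup (ZMod q × Fin d) ℂ)
  continuous_toFun := by
    apply QuotientGroup.continuous_mk.comp
    apply Continuous.subtype_mk
    apply continuous_matrix
    rintro ⟨i, i'⟩ ⟨j, j'⟩
    simp only [Matrix.kroneckerMap_apply, shiftDiagMatrix, Matrix.of_apply]
    by_cases h : j - i = ((q - 1 : ℕ) : ZMod q)
    · simp only [h, eq_self_iff_true, if_true]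
      by_cases h0 : i = 0
      · simp only [h0, eq_self_iff_true, if_true]
        have hcoe : Continuous fun w : Circle => (w : ℂ) := continuous_subtype_val
        exact (hcoe.comp (continuous_zpow p)).mul continuous_const
      · simp only [h0, if_false]
        exact continuous_const
    · simp only [h, if_false]
      exact continuous_const

open Topology in
set_option maxHeartbeats 1000000 in
theorem cover_aux {G V : Type*} [Group G] [TopologicalSpace G] [IsTopologicalGroup G] [Group V]
    (H : Subgroup G) (κ : V →* G) (hκ : ∀ g, g ∈ H ↔ ∃ v, κ v = g)
    (k : ℕ) (hk : 0 < k) (χ : G →* Circle) (hχ : Continuous χ) (ε : V →* Circle)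
    (δ : G → ℂ) (hδ : Continuous δ) (hδε : ∀ v, δ (κ v) = ε v) (hχε : ∀ v, χ (κ v) = ε v ^ k)
    (g : C(Circle, G)) (c : Circle) (m : ℤ) (hg : ∀ z, χ (g z) = c * z ^ m)
    (γ : C(Circle, G ⧸ H)) (hγ : ∀ z, γ z = QuotientGroup.mk (g z))
    (hnull : ContinuousMap.Nullhomotopic γ) : (k : ℤ) ∣ m := by
  let P : Subgroup (G × Circle) :=
    MonoidHom.eqLocus ((powMonoidHom k).comp (MonoidHom.snd G Circle)) (χ.comp (MonoidHom.fst G Circle))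
  have hP : ∀ x : G × Circle, x ∈ P ↔ x.2 ^ k = χ x.1 := fun x => Iff.rfl
  let pr : P →* G := (MonoidHom.fst G Circle).comp P.subtype
  let j : V →* P := (κ.prod ε).codRestrict P (fun v => (hP _).2 (hχε v).symm)
  have hj1 : ∀ v, pr (j v) = κ v := fun v => rfl
  have hj2 : ∀ v, (j v).1.2 = ε v := fun v => rfl
  let N : Subgroup P := pr.ker
  let f : P ⧸ j.range → G ⧸ H := Quotient.map' pr (by
    intro a b hab
    rw [QuotientGroup.leftRel_apply] at hab ⊢
    obtain ⟨v, hv⟩ := hab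
    rw [hκ]
    exact ⟨v, by rw [← hj1, hv]; simp⟩)
  have hf : ∀ x : P, f (QuotientGroup.mk x) = QuotientGroup.mk (pr x) := fun x => rfl
  have prc : Continuous pr := continuous_fst.comp continuous_subtype_val
  have hPc : IsClosed (P : Set (G × Circle)) :=
    isClosed_eq (continuous_snd.pow k) (hχ.comp continuous_fst)
  have prs : Function.Surjective pr := by
    intro a
    obtain ⟨t, ht⟩ := Circle.exp_surjective (χ a)
    refine ⟨⟨(a, Circle.exp (t / k)), (hP _).2 ?_⟩, rfl⟩
    have hk' : (k : ℝ) ≠ 0 := by positivity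
    change Circle.exp (t / k) ^ k = χ a
    rw [← Circle.exp_nsmul, nsmul_eq_mul, mul_div_cancel₀ _ hk', ht]
  have prq : IsQuotientMap pr := by
    refine IsClosedMap.isQuotientMap ?_ prc prs
    exact isClosedMap_fst_of_compactSpace.comp hPc.isClosedMap_subtype_val
  have hfc : Continuous f := by
    refine continuous_quot_lift _ ?_
    exact QuotientGroup.continuous_mk.comp prc
  have hfq : IsQuotientMap f := by
    refine IsQuotientMap.of_comp QuotientGroup.continuous_mk hfc ?_
    have := IsQuotientMap.comp (QuotientGroup.isQuotientMap_mk H) prq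
    exact this
  have hNc : ∀ n ∈ N, ∀ x : P, n * x = x * n := by
    intro n hn x
    have h1 : n.1.1 = 1 := hn
    apply Subtype.ext
    apply Prod.ext
    · change n.1.1 * x.1.1 = x.1.1 * n.1.1
      rw [h1, one_mul, mul_one]
    · exact mul_comm _ _
  have fib : ∀ x y : P, f (QuotientGroup.mk x) = f (QuotientGroup.mk y) →
      ∃ n ∈ N, ∃ v, x = n * y * j v := by
    intro x y hxy
    rw [hf, hf, eq_comm, QuotientGroup.eq, hκ] at hxy
    obtain ⟨v, hv⟩ := hxy
    refine ⟨x * (y * j v)⁻¹, ?_, v, by group⟩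
    rw [MonoidHom.mem_ker]
    rw [map_mul, map_inv, map_mul, hj1, hv]
    group
  obtain ⟨A, hA, h1A, hAn⟩ : ∃ A : Set P, IsOpen A ∧ 1 ∈ A ∧
      ∀ n ∈ N, ∀ v, n * j v ∈ A → n = 1 := by
    let B : Set ℂ := {w | w ^ k = 1 ∧ w ≠ 1}
    have hB : IsClosed B := by
      refine Set.Finite.isClosed ?_
      refine Set.Finite.subset (Polynomial.nthRoots k (1 : ℂ)).toFinset.finite_toSet ?_
      intro w hw
      simp [Polynomial.mem_nthRoots hk, hw.1]
    let φ : P → ℂ := fun y => (y.1.2 : ℂ) * ((starRingEnd ℂ) (δ y.1.1))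
    have hφ : Continuous φ := by fun_prop
    let A : Set P := φ ⁻¹' Bᶜ
    have hA : IsOpen A := hB.isOpen_compl.preimage hφ
    have hφj : ∀ n ∈ N, ∀ v, φ (n * j v) = n.1.2 := by
      intro n hn v
      have h1 : n.1.1 = 1 := hn
      change ((n.1.2 * ε v : Circle) : ℂ) * ((starRingEnd ℂ) (δ (n.1.1 * κ v))) = _
      rw [h1, one_mul, hδε, Circle.coe_mul, mul_assoc, Complex.mul_conj]
      simp
    have h1A : (1 : P) ∈ A := by
      have := hφj 1 (one_mem _) 1
      rw [map_one, mul_one] at this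
      change φ 1 ∉ B
      rw [this]
      simp [B]
    refine ⟨A, hA, h1A, fun n hn v h3 => ?_⟩
    have h4 : φ (n * j v) ∉ B := h3
    rw [hφj n hn v] at h4
    have h5 : n.1.1 = 1 := hn
    have h6 : n.1.2 ^ k = 1 := by rw [(hP _).1 n.2, h5, map_one]
    have h7 : n.1.2 = 1 := by
      by_contra h7
      exact h4 ⟨by rw [← Circle.coe_pow, h6, Circle.coe_one],
        fun h8 => h7 (Circle.ext (by simpa using h8))⟩
    exact Subtype.ext (Prod.ext h5 h7)
  have cov : IsQuotientCoveringMap f N := by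
    refine { toIsQuotientMap := hfq, toContinuousConstSMul := ⟨fun n => continuous_const_smul (n : P)⟩, apply_eq_iff_mem_orbit := ?_, disjoint := ?_}
    · intro e₁ e₂
      induction e₁ using QuotientGroup.induction_on with | H x => ?_
      induction e₂ using QuotientGroup.induction_on with | H y => ?_
      constructor
      · intro h
        obtain ⟨n, hn, v, hv⟩ := fib x y h
        refine ⟨⟨n, hn⟩, ?_⟩
        change (QuotientGroup.mk (n * y) : P ⧸ j.range) = QuotientGroup.mk x
        rw [QuotientGroup.eq, hv]
        exact ⟨v, by group⟩
      · rintro ⟨⟨n, hn⟩, h⟩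
        have h' : (QuotientGroup.mk (n * y) : P ⧸ j.range) = QuotientGroup.mk x := h
        rw [← h', hf, hf, map_mul, MonoidHom.mem_ker.1 hn, one_mul]
    · intro e
      induction e using QuotientGroup.induction_on with | H x => ?_
      have hlim : Filter.Tendsto (fun y : P × P => (x * y.1)⁻¹ * (x * y.2)) (𝓝 (1, 1)) (𝓝 1) := by
        have : Continuous (fun y : P × P => (x * y.1)⁻¹ * (x * y.2)) := by fun_prop
        simpa using this.tendsto (1, 1)
      have := hlim (hA.mem_nhds h1A)
      rw [Filter.mem_map, nhds_prod_eq, Filter.mem_prod_same_iff] at this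
      obtain ⟨W, hW, hWA⟩ : ∃ W ∈ 𝓝 (1 : P), ∀ w ∈ W, ∀ w' ∈ W, (x * w)⁻¹ * (x * w') ∈ A := by
        obtain ⟨W, hW, hWA⟩ := this
        exact ⟨W, hW, fun w hw w' hw' => @hWA (w, w') ⟨hw, hw'⟩⟩
      refine ⟨(fun y : P => (QuotientGroup.mk (x * y) : P ⧸ j.range)) '' W, ?_, ?_⟩
      · have hop : IsOpenMap (fun y : P => (QuotientGroup.mk (x * y) : P ⧸ j.range)) :=
          QuotientGroup.isOpenMap_coe.comp (isOpenMap_mul_left x)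
        simpa using hop.image_mem_nhds hW
      · rintro ⟨n, hn⟩ ⟨_, ⟨_, ⟨w, hw, rfl⟩, rfl⟩, ⟨w', hw', h⟩⟩
        have h' : (QuotientGroup.mk (n * (x * w)) : P ⧸ j.range) = QuotientGroup.mk (x * w') := h.symm
        rw [QuotientGroup.eq] at h'
        obtain ⟨v, hv⟩ := h'
        have h2 : (x * w)⁻¹ * (x * w') = n * j v := by
          have hc := hNc n hn (x * w)⁻¹
          rw [hv, mul_inv_rev n, ← mul_assoc n, ← mul_assoc n, hc, mul_assoc (x * w)⁻¹,
            mul_inv_cancel, mul_one]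
        have h3 : (x * w)⁻¹ * (x * w') ∈ A := hWA w hw w' hw'
        rw [h2] at h3
        exact Subtype.ext (hAn n hn v h3)
  have cm := cov.isCoveringMap
  obtain ⟨y, hy⟩ := hnull
  obtain ⟨F⟩ := hy.symm
  obtain ⟨e, he⟩ := hfq.surjective y
  let L := cm.liftHomotopy F.toContinuousMap (ContinuousMap.const Circle e)
    (fun a => by simpa using he.symm)
  have hL : ∀ t a, f (L (t, a)) = F (t, a) := fun t a =>
    congrFun (cm.liftHomotopy_lifts F.toContinuousMap (ContinuousMap.const Circle e) _) (t, a)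
  let Γ : Circle → P ⧸ j.range := fun z => L (1, z)
  have hΓc : Continuous Γ := L.continuous.comp (by fun_prop)
  have hΓ : ∀ z, f (Γ z) = QuotientGroup.mk (g z) := by
    intro z
    rw [← hγ, hL, F.apply_one]
  obtain ⟨x, hx⟩ := QuotientGroup.mk_surjective (Γ 1)
  have hx1 : f (QuotientGroup.mk x) = QuotientGroup.mk (g 1) := by rw [hx, hΓ]
  rw [hf, QuotientGroup.eq, hκ] at hx1
  obtain ⟨v, hv⟩ := hx1
  let x' : P := x * j v
  have hx'1 : x'.1.1 = g 1 := by
    change pr (x * j v) = g 1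
    rw [map_mul, hj1, hv]; group
  have hx' : (QuotientGroup.mk x' : P ⧸ j.range) = Γ 1 := by
    rw [← hx, eq_comm, QuotientGroup.eq]
    exact ⟨v, by simp [x']⟩
  have hkR : (k : ℝ) ≠ 0 := by positivity
  have hc : x'.1.2 ^ k = c := by
    rw [(hP _).1 x'.2, hx'1, hg]; simp
  let l : ℝ → P := fun t => ⟨(g (Circle.exp t), x'.1.2 * Circle.exp (m * t / k)), by
    rw [hP]
    change (x'.1.2 * Circle.exp (m * t / k)) ^ k = χ (g (Circle.exp t))
    rw [hg, mul_pow, hc, ← Circle.exp_nsmul, nsmul_eq_mul, mul_div_cancel₀ _ hkR,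
      ← Circle.exp_zsmul, zsmul_eq_mul]⟩
  have hlc : Continuous l := by
    refine Continuous.subtype_mk ?_ _
    fun_prop
  have hl0 : l 0 = x' := by
    apply Subtype.ext
    apply Prod.ext
    · simp [l, hx'1]
    · simp [l]
  have key : (fun t => (QuotientGroup.mk (l t) : P ⧸ j.range)) = fun t => Γ (Circle.exp t) := by
    refine cm.eq_of_comp_eq (QuotientGroup.continuous_mk.comp hlc)
      (hΓc.comp Circle.exp.continuous) ?_ 0 ?_
    · funext t
      change f (QuotientGroup.mk (l t)) = f (Γ (Circle.exp t))
      rw [hf, hΓ]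
      rfl
    · rw [hl0, hx', Circle.exp_zero]
  have h2 : (QuotientGroup.mk (l 0) : P ⧸ j.range) = QuotientGroup.mk (l (2 * Real.pi)) := by
    rw [congrFun key (2 * Real.pi), Circle.exp_two_pi, hl0, hx']
  rw [QuotientGroup.eq, hl0] at h2
  obtain ⟨u, hu⟩ := h2
  have hu1 : κ u = 1 := by
    rw [← hj1, hu, map_mul, map_inv]
    change (x'.1.1)⁻¹ * g (Circle.exp (2 * Real.pi)) = 1
    rw [hx'1, Circle.exp_two_pi]; group
  have hu2 : ε u = 1 := by
    apply Circle.ext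
    rw [← hδε, hu1, ← map_one κ, hδε, map_one]
  have hu3 : Circle.exp (m * (2 * Real.pi) / k) = 1 := by
    rw [← hu2, ← hj2, hu]
    change _ = (x'.1.2)⁻¹ * (x'.1.2 * Circle.exp (m * (2 * Real.pi) / k))
    group
  rw [Circle.exp_eq_one] at hu3
  obtain ⟨n, hn⟩ := hu3
  refine ⟨n, ?_⟩
  have hpi := Real.pi_pos
  have : (m : ℝ) = k * n := by
    field_simp at hn
    linarith
  exact_mod_cast this

theorem homotopic_one_mul {G : Type*} [Group G] [TopologicalSpace G] [IsTopologicalGroup G]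
    {f f' g g' : C(Circle, G)} (hf : f.Homotopic f') (hg : g.Homotopic g') :
    (f * g).Homotopic (f' * g') := by
  have h := ContinuousMap.Homotopic.comp
    (ContinuousMap.Homotopic.refl (⟨fun x : G × G => x.1 * x.2, continuous_mul⟩ : C(G × G, G)))
    (hf.prodMk hg)
  exact h

theorem homotopic_commutator {G : Type*} [Group G] [TopologicalSpace G] [IsTopologicalGroup G]
    (f : C(Circle, G)) (s : G) (hs : Joined (1 : G) s) :
    (1 : C(Circle, G)).Homotopic
      (f * (ContinuousMap.const Circle s * f⁻¹ * ContinuousMap.const Circle s⁻¹)) := by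
  obtain ⟨γ⟩ := hs
  refine ⟨⟨⟨fun x => f x.2 * (γ x.1 * (f x.2)⁻¹ * (γ x.1)⁻¹), by fun_prop⟩, ?_, ?_⟩⟩
  · intro x; simp
  · intro x; simp

theorem joined_involution {n : Type*} [Fintype n] [DecidableEq n]
    (S : Matrix.unitaryGroup n ℂ) (hS : S * S = 1) : Joined (1 : Matrix.unitaryGroup n ℂ) S := by
  have h1 : (S : Matrix n n ℂ) * (S : Matrix n n ℂ) = 1 := congrArg Subtype.val hS
  have h2 : star (S : Matrix n n ℂ) = (S : Matrix n n ℂ) := by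
    have h3 : S⁻¹ = S := inv_eq_of_mul_eq_one_left hS
    exact congrArg Subtype.val h3
  have hm : ∀ t : ℝ, (((1 + (Circle.exp t : ℂ)) / 2) • (1 : Matrix n n ℂ)
      + ((1 - (Circle.exp t : ℂ)) / 2) • (S : Matrix n n ℂ)) ∈ Matrix.unitaryGroup n ℂ := by
    intro t
    have hw : (Circle.exp t : ℂ) * (starRingEnd ℂ) (Circle.exp t : ℂ) = 1 := by
      rw [Complex.mul_conj, Circle.normSq_coe, Complex.ofReal_one]
    generalize (Circle.exp t : ℂ) = w at hw
    rw [Matrix.mem_unitaryGroup_iff, star_add, star_smul, star_smul, h2, star_one]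
    simp only [add_mul, mul_add, smul_mul_assoc, mul_smul_comm, h1, one_mul, mul_one, smul_add,
      smul_smul]
    have e1 : ∀ a b c e : ℂ, a + e = 1 → b + c = 0 →
        a • (1 : Matrix n n ℂ) + b • (S : Matrix n n ℂ) + (c • (S : Matrix n n ℂ) + e • 1) = 1 := by
      intro a b c e h h'
      have : a • (1 : Matrix n n ℂ) + b • (S : Matrix n n ℂ) + (c • (S : Matrix n n ℂ) + e • 1)
        = (a + e) • (1 : Matrix n n ℂ) + (b + c) • (S : Matrix n n ℂ) := by
        rw [add_smul, add_smul]; abel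
      rw [this, h, h']; simp
    apply e1
    · simp
      linear_combination (1 / 2) * hw
    · simp
      linear_combination (-1 / 2) * hw
  refine ⟨⟨⟨fun t => ⟨_, hm (Real.pi * t)⟩, ?_⟩, ?_, ?_⟩⟩
  · refine Continuous.subtype_mk ?_ _
    fun_prop
  · apply Subtype.ext
    simp
  · apply Subtype.ext
    simp

noncomputable def diagLoop {n : Type*} [Fintype n] [DecidableEq n] (a : n → ℤ) :
    C(Circle, Matrix.unitaryGroup n ℂ) where
  toFun z := ⟨Matrix.diagonal fun i => ((z ^ a i : Circle) : ℂ),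
    diag_circle_mem_unitaryGroup _ (fun i => by simp)⟩
  continuous_toFun := by
    refine Continuous.subtype_mk ?_ _
    refine Continuous.matrix_diagonal ?_
    refine continuous_pi fun i => ?_
    exact continuous_subtype_val.comp (continuous_zpow _)

theorem diagLoop_add {n : Type*} [Fintype n] [DecidableEq n] (a b : n → ℤ) :
    diagLoop (a + b) = diagLoop a * diagLoop b := by
  ext1 z
  apply Subtype.ext
  simp [diagLoop, zpow_add, Matrix.diagonal_mul_diagonal]

theorem diagLoop_zero {n : Type*} [Fintype n] [DecidableEq n] :
    diagLoop (0 : n → ℤ) = 1 := by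
  ext1 z
  apply Subtype.ext
  simp [diagLoop]

theorem diagLoop_single {n : Type*} [Fintype n] [DecidableEq n] (i j : n) (k : ℤ) :
    (1 : C(Circle, Matrix.unitaryGroup n ℂ)).Homotopic
      (diagLoop (Pi.single i k - Pi.single j k)) := by
  let S : Matrix.unitaryGroup n ℂ :=
    ⟨(Equiv.swap i j).toPEquiv.toMatrix, perm_mem_unitaryGroup _⟩
  have hS : S * S = 1 := by
    apply Subtype.ext
    change (Equiv.swap i j).toPEquiv.toMatrix * (Equiv.swap i j).toPEquiv.toMatrix = 1
    rw [← PEquiv.toMatrix_trans, ← Equiv.toPEquiv_trans]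
    simp [← Equiv.Perm.mul_def]
  have hSi : S⁻¹ = S := inv_eq_of_mul_eq_one_left hS
  convert homotopic_commutator (diagLoop (Pi.single i k)) S (joined_involution S hS) using 1
  have hi : (diagLoop (Pi.single i k))⁻¹ = diagLoop (Pi.single i (-k) : n → ℤ) := by
    rw [inv_eq_iff_mul_eq_one, ← diagLoop_add, ← Pi.single_add]
    simp [diagLoop_zero]
  rw [sub_eq_add_neg, diagLoop_add, hi, hSi]
  congr 1
  rw [← Pi.single_neg]
  ext1 z
  apply Subtype.ext
  change Matrix.diagonal _ = (Equiv.swap i j).toPEquiv.toMatrix * Matrix.diagonal _ *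
    (Equiv.swap i j).toPEquiv.toMatrix
  rw [PEquiv.toMatrix_toPEquiv_mul, PEquiv.mul_toMatrix_toPEquiv, Matrix.submatrix_submatrix]
  simp only [Equiv.symm_swap, Function.comp_id, Function.id_comp]
  rw [Matrix.submatrix_diagonal _ _ (Equiv.injective _)]
  congr 1
  funext l
  simp only [Function.comp]
  congr 2
  rw [Pi.single_apply, Pi.single_apply]
  congr 1
  rw [Equiv.swap_apply_eq_iff, Equiv.swap_apply_left]

theorem diagLoop_homotopic {n : Type*} [Fintype n] [DecidableEq n] (a b : n → ℤ)
    (hab : ∑ i, a i = ∑ i, b i) : (diagLoop a).Homotopic (diagLoop b) := by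
  classical
  rcases isEmpty_or_nonempty n with hn | ⟨⟨o⟩⟩
  · rw [Subsingleton.elim a b]
  have key : ∀ s : Finset n, (1 : C(Circle, Matrix.unitaryGroup n ℂ)).Homotopic
      (diagLoop (∑ i ∈ s, (Pi.single i (b i - a i) - Pi.single o (b i - a i)))) := by
    intro s
    induction s using Finset.induction_on with
    | empty => rw [Finset.sum_empty, diagLoop_zero]
    | insert i s his ih =>
      rw [Finset.sum_insert his, diagLoop_add]
      have := homotopic_one_mul (diagLoop_single i o (b i - a i)) ih
      rwa [one_mul] at this
  have h := homotopic_one_mul (ContinuousMap.Homotopic.refl (diagLoop a)) (key Finset.univ)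
  rw [mul_one, ← diagLoop_add] at h
  convert h using 2
  rw [Finset.sum_sub_distrib]
  have e1 : (∑ i, Pi.single i (b i - a i) : n → ℤ) = b - a := by
    exact Finset.univ_sum_single (b - a)
  have e2 : (∑ i, Pi.single o (b i - a i) : n → ℤ) = 0 := by
    funext l
    rw [Finset.sum_apply]
    by_cases hl : l = o
    · subst hl
      simp [hab]
    · simp [hl]
  rw [e1, e2]; simp

noncomputable def detCircle (n : Type*) [Fintype n] [DecidableEq n] :
    Matrix.unitaryGroup n ℂ →* Circle where
  toFun u := ⟨(u : Matrix n n ℂ).det, by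
    have h := Matrix.det_of_mem_unitary u.2
    rw [Unitary.mem_iff] at h
    change _ ∈ Metric.sphere (0 : ℂ) 1
    rw [mem_sphere_zero_iff_norm]
    have h2 := h.2
    rw [Complex.star_def, Complex.mul_conj, Complex.normSq_eq_norm_sq] at h2
    have h3 : ‖(u : Matrix n n ℂ).det‖ ^ 2 = 1 := by exact_mod_cast h2
    exact (pow_eq_one_iff_of_nonneg (norm_nonneg _) two_ne_zero).1 h3⟩
  map_one' := by
    apply Circle.ext
    exact Matrix.det_one
  map_mul' u v := by
    apply Circle.ext
    exact Matrix.det_mul _ _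

theorem detCircle_coe {n : Type*} [Fintype n] [DecidableEq n] (u : Matrix.unitaryGroup n ℂ) :
    (detCircle n u : ℂ) = (u : Matrix n n ℂ).det := rfl

theorem continuous_detCircle (n : Type*) [Fintype n] [DecidableEq n] :
    Continuous (detCircle n) :=
  Continuous.subtype_mk (continuous_subtype_val.matrix_det) _

theorem detCircle_diagLoop {n : Type*} [Fintype n] [DecidableEq n] (a : n → ℤ) (z : Circle) :
    detCircle n (diagLoop a z) = z ^ (∑ i, a i) := by
  apply Circle.ext
  rw [detCircle_coe]
  change (Matrix.diagonal _).det = _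
  have hz : ∀ s : Finset n, z ^ (∑ i ∈ s, a i) = ∏ i ∈ s, z ^ a i := by
    intro s
    induction s using Finset.induction_on with
    | empty => simp
    | insert i s hi ih => rw [Finset.sum_insert hi, Finset.prod_insert hi, zpow_add, ih]
  rw [Matrix.det_diagonal, hz]
  exact (map_prod Circle.coeHom (fun i => z ^ a i) Finset.univ).symm

noncomputable def tensorHom (r d : ℕ) [NeZero r] :
    Matrix.unitaryGroup (Fin d) ℂ →* Matrix.unitaryGroup (ZMod r × Fin d) ℂ where
  toFun v := ⟨(1 : Matrix (ZMod r) (ZMod r) ℂ) ⊗ₖ (v : Matrix (Fin d) (Fin d) ℂ), by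
    rw [Matrix.mem_unitaryGroup_iff', star_kronecker_star', star_one, ← Matrix.mul_kronecker_mul,
      Matrix.mem_unitaryGroup_iff'.mp v.2, one_mul, Matrix.one_kronecker_one]⟩
  map_one' := Subtype.ext Matrix.one_kronecker_one
  map_mul' u v := by
    apply Subtype.ext
    change (1 : Matrix (ZMod r) (ZMod r) ℂ) ⊗ₖ ((u : Matrix (Fin d) (Fin d) ℂ) *
      (v : Matrix (Fin d) (Fin d) ℂ)) =
      ((1 : Matrix (ZMod r) (ZMod r) ℂ) ⊗ₖ (u : Matrix (Fin d) (Fin d) ℂ)) *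
      ((1 : Matrix (ZMod r) (ZMod r) ℂ) ⊗ₖ (v : Matrix (Fin d) (Fin d) ℂ))
    rw [← Matrix.mul_kronecker_mul, one_mul]

noncomputable def shiftConst (r d : ℕ) [NeZero r] : Matrix.unitaryGroup (ZMod r × Fin d) ℂ :=
  ⟨((Equiv.addRight (((r - 1 : ℕ) : ZMod r))).toPEquiv.toMatrix : Matrix (ZMod r) (ZMod r) ℂ) ⊗ₖ
    (1 : Matrix (Fin d) (Fin d) ℂ), kronecker_one_mem_unitaryGroup (perm_mem_unitaryGroup _)⟩

theorem shift_factor (r d : ℕ) [NeZero r] (p : ℤ) (z : Circle) :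
    (⟨shiftDiagMatrix r p z ⊗ₖ (1 : Matrix (Fin d) (Fin d) ℂ),
      kronecker_one_mem_unitaryGroup (shiftDiagMatrix_mem r p z)⟩ :
      Matrix.unitaryGroup (ZMod r × Fin d) ℂ) =
    diagLoop (fun x : ZMod r × Fin d => if x.1 = 0 then p else 0) z * shiftConst r d := by
  apply Subtype.ext
  change shiftDiagMatrix r p z ⊗ₖ (1 : Matrix (Fin d) (Fin d) ℂ) = Matrix.diagonal _ *
    (((Equiv.addRight (((r - 1 : ℕ) : ZMod r))).toPEquiv.toMatrix : Matrix (ZMod r) (ZMod r) ℂ) ⊗ₖ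
    (1 : Matrix (Fin d) (Fin d) ℂ))
  rw [shiftDiagMatrix_decomp]
  conv_lhs => rw [← one_mul (1 : Matrix (Fin d) (Fin d) ℂ)]
  rw [Matrix.mul_kronecker_mul]
  congr 1
  rw [← Matrix.diagonal_one, Matrix.diagonal_kronecker_diagonal]
  congr 1
  funext x
  by_cases h : x.1 = 0 <;> simp [h]

theorem sum_first (r d : ℕ) [NeZero r] (p : ℤ) :
    ∑ x : ZMod r × Fin d, (if x.1 = 0 then p else 0) = p * d := by
  have aux : ∀ F : ZMod r → ℤ, ∑ x : ZMod r × Fin d, F x.1 = d * ∑ i, F i := by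
    intro F
    rw [Fintype.sum_prod_type]
    simp [Finset.mul_sum]
  exact (aux (fun i => if i = 0 then p else 0)).trans (by simp [mul_comm])

theorem sum_second (r d : ℕ) [NeZero r] (hd : 1 ≤ d) (m : ℤ) :
    ∑ x : ZMod r × Fin d, (if x.2 = ⟨0, hd⟩ then m else 0) = r * m := by
  rw [Fintype.sum_prod_type]
  simp [ZMod.card]

theorem null_forward (r d : ℕ) [NeZero r] (p : ℤ)
    (h : ContinuousMap.Nullhomotopic (shiftDiagLoop r d p)) : (r : ℤ) ∣ p * d := by
  refine cover_aux (oneTensorUnitary' r d) (tensorHom r d) ?_ r (Nat.pos_of_ne_zero (NeZero.ne r))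
    (detCircle _) (continuous_detCircle _) (detCircle _)
    (fun g => ((g : Matrix (ZMod r × Fin d) (ZMod r × Fin d) ℂ).submatrix
      (fun i => (0, i)) (fun i => (0, i))).det) ?_ ?_ ?_
    (diagLoop (fun x : ZMod r × Fin d => if x.1 = 0 then p else 0) *
      ContinuousMap.const Circle (shiftConst r d))
    (detCircle _ (shiftConst r d)) (p * d) ?_ (shiftDiagLoop r d p) ?_ h
  · intro g
    constructor
    · rintro ⟨v, hv⟩
      exact ⟨v, Subtype.ext hv.symm⟩
    · rintro ⟨v, rfl⟩
      exact ⟨v, rfl⟩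
  · exact (continuous_subtype_val.matrix_submatrix _ _).matrix_det
  · intro v
    rw [detCircle_coe]
    congr 1
    ext i j
    simp [tensorHom]
  · intro v
    apply Circle.ext
    rw [Circle.coe_pow, detCircle_coe, detCircle_coe]
    change ((1 : Matrix (ZMod r) (ZMod r) ℂ) ⊗ₖ (v : Matrix (Fin d) (Fin d) ℂ)).det = _
    rw [Matrix.det_kronecker]
    simp [ZMod.card]
  · intro z
    rw [ContinuousMap.mul_apply, map_mul, detCircle_diagLoop, sum_first, mul_comm]
    rfl
  · intro z
    exact congrArg _ (shift_factor r d p z)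

theorem null_backward (r d : ℕ) [NeZero r] (hd : 1 ≤ d) (p : ℤ) (h : (r : ℤ) ∣ p * d) :
    ContinuousMap.Nullhomotopic (shiftDiagLoop r d p) := by
  obtain ⟨m, hm⟩ := h
  have h1 := diagLoop_homotopic (fun x : ZMod r × Fin d => if x.1 = 0 then p else 0)
    (fun x => if x.2 = ⟨0, hd⟩ then m else 0) (by rw [sum_first, sum_second, hm])
  have h2 := homotopic_one_mul h1
    (ContinuousMap.Homotopic.refl (ContinuousMap.const Circle (shiftConst r d)))
  have h3 := ContinuousMap.Homotopic.comp (ContinuousMap.Homotopic.refl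
    (⟨QuotientGroup.mk, QuotientGroup.continuous_mk⟩ :
      C(Matrix.unitaryGroup (ZMod r × Fin d) ℂ,
        Matrix.unitaryGroup (ZMod r × Fin d) ℂ ⧸ oneTensorUnitary' r d))) h2
  refine ⟨QuotientGroup.mk (shiftConst r d), ?_⟩
  convert h3 using 1
  · ext1 z
    exact congrArg _ (shift_factor r d p z)
  · ext1 z
    change QuotientGroup.mk (shiftConst r d) = QuotientGroup.mk
      (diagLoop (fun x : ZMod r × Fin d => if x.2 = ⟨0, hd⟩ then m else 0) z * shiftConst r d)
    let v := diagLoop (fun j : Fin d => if j = ⟨0, hd⟩ then m else 0) z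
    have e1 : diagLoop (fun x : ZMod r × Fin d => if x.2 = ⟨0, hd⟩ then m else 0) z =
        tensorHom r d v := by
      apply Subtype.ext
      change Matrix.diagonal _ = (1 : Matrix (ZMod r) (ZMod r) ℂ) ⊗ₖ Matrix.diagonal _
      rw [← Matrix.diagonal_one, Matrix.diagonal_kronecker_diagonal]
      simp
    have e2 : tensorHom r d v * shiftConst r d = shiftConst r d * tensorHom r d v := by
      apply Subtype.ext
      change (_ ⊗ₖ _) * (_ ⊗ₖ _) = (_ ⊗ₖ _) * (_ ⊗ₖ _)
      rw [← Matrix.mul_kronecker_mul, ← Matrix.mul_kronecker_mul, one_mul, mul_one, one_mul,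
        mul_one]
    rw [e1, e2, QuotientGroup.eq, inv_mul_cancel_left]
    exact ⟨v, rfl⟩

/-- Let `q, d ≥ 1` and `p ∈ ℤ`.  The continuous loop
`γ : S¹ → U(qd)/(I_q ⊗ U(d))` sending `z` to the coset of `diag_{q−1}(z^p, 1, …, 1) ⊗ I_d`
is nullhomotopic if and only if `q` divides `p·d`; in particular, if `gcd(p,q) = 1`, then `γ` is
nullhomotopic if and only if `q` divides `d`. -/
theorem shiftDiagLoop_nullhomotopic_iff (q d : ℕ) [NeZero q] (hd : 1 ≤ d) (p : ℤ) :
    (ContinuousMap.Nullhomotopic (shiftDiagLoop q d p) ↔ (q : ℤ) ∣ p * d) ∧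
    (Int.gcd p q = 1 →
      (ContinuousMap.Nullhomotopic (shiftDiagLoop q d p) ↔ (q : ℤ) ∣ (d : ℤ))) := by
  have main : ContinuousMap.Nullhomotopic (shiftDiagLoop q d p) ↔ (q : ℤ) ∣ p * d :=
    ⟨null_forward q d p, null_backward q d hd p⟩
  refine ⟨main, fun hpq => main.trans ⟨fun h => ?_, fun h => Dvd.dvd.mul_left h p⟩⟩
  exact Int.dvd_of_dvd_mul_right_of_gcd_one h (by rw [Int.gcd_comm]; exact hpq)
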